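/- The Fishburn domain on 8 alternatives, namely the set of all linear orders on {1,...,8} such that for every triple a < b < c the element b is never ranked last among {a,b,c} if b is even, and b is never ranked first among {a,b,c} if b is odd, has exactly 222 elements. -/

import Mathlib

/-- The (1-indexed) rank of the element `x` within the triple `{a, b, c}` under the
linear order `w` on `Fin n`, where `w k` is the element ranked in position `k`
(so `w.symm y` is the position of the element `y`). -/
def tripleRank {n : ℕ} (w : Equiv.Perm (Fin n)) (a b c x : Fin n) : ℕ :=
  (({a, b, c} : Finset (Fin n)).filter (fun y => w.symm y ≤ w.symm x)).card

/-- A Condorcet domain on `X_n = {1, ..., n}` (modelled as `Fin n`): for every triple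
`a < b < c` there is an element `x` of the triple and a position `i ∈ {1, 2, 3}` such
that no order of `D` places `x` in position `i` when restricted to `{a, b, c}`. -/
def IsCondorcet (n : ℕ) (D : Set (Equiv.Perm (Fin n))) : Prop :=
  ∀ a b c : Fin n, a < b → b < c →
    ∃ x ∈ ({a, b, c} : Finset (Fin n)), ∃ i ∈ ({1, 2, 3} : Finset ℕ),
      ∀ w ∈ D, tripleRank w a b c x ≠ i

/-- The Fishburn domain on 8 alternatives: all linear orders `w` on `{1, ..., 8}`
(alternative `k` modelled as `k - 1 : Fin 8`, so the alternative corresponding to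
`b : Fin 8` is the number `(b : ℕ) + 1`) such that for every triple `a < b < c`,
the middle element `b` is never ranked last among `{a, b, c}` if `b` is even, and
never ranked first among `{a, b, c}` if `b` is odd. -/
def Fishburn8 : Set (Equiv.Perm (Fin 8)) :=
  {w | ∀ a b c : Fin 8, a < b → b < c →
    (Even ((b : ℕ) + 1) → tripleRank w a b c b ≠ 3) ∧
    (Odd ((b : ℕ) + 1) → tripleRank w a b c b ≠ 1)}

/-- May the alternative `b` be appended to the (reversed) prefix `l`? -/
def okB (l : List ℕ) (b : ℕ) : Bool :=
  !(l.elem b) &&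
  (match b % 2 with
   | 0 => !((List.range 8).any (fun a => Nat.blt a b && !(l.elem a)) &&
        (List.range 8).any (fun c => Nat.blt b c && !(l.elem c)))
   | _ => !((List.range 8).any (fun a => Nat.blt a b && l.elem a) &&
        (List.range 8).any (fun c => Nat.blt b c && l.elem c)))

/-- All admissible reversed prefixes of length `k`. -/
def enumP : ℕ → List (List ℕ)
  | 0 => [[]]
  | k + 1 => (enumP k).flatMap (fun l => ((List.range 8).filter (okB l)).map (fun b => b :: l))

/-- The order as a function on the naturals. -/
def wfun (w : Equiv.Perm (Fin 8)) (i : ℕ) : ℕ := if h : i < 8 then (w ⟨i, h⟩ : ℕ) else 0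

/-- The reversed prefix of length `k`. -/
def pre (w : Equiv.Perm (Fin 8)) : ℕ → List ℕ
  | 0 => []
  | k + 1 => wfun w k :: pre w k

theorem enum_length : (enumP 8).length = 222 := by decide +kernel

theorem enum_nodup (k : ℕ) : (enumP k).Nodup := by
  induction k with
  | zero => simp [enumP]
  | succ k ih =>
    rw [enumP, List.nodup_flatMap]
    refine ⟨fun l _ => ?_, ?_⟩
    · apply List.Nodup.map (fun a b h => by simpa using h)
      exact List.Nodup.filter _ List.nodup_range
    · refine ih.imp ?_
      intro l m hlm x hx hy
      simp only [List.mem_map] at hx hy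
      obtain ⟨a, -, rfl⟩ := hx
      obtain ⟨b, -, h⟩ := hy
      simp only [List.cons.injEq] at h
      exact hlm h.2.symm

theorem mem_pre (w : Equiv.Perm (Fin 8)) (k x : ℕ) : x ∈ pre w k ↔ ∃ i < k, wfun w i = x := by
  induction k with
  | zero => simp [pre]
  | succ k ih =>
    rw [pre, List.mem_cons, ih]
    constructor
    · rintro (h | ⟨i, hi, h⟩)
      · exact ⟨k, by omega, h.symm⟩
      · exact ⟨i, by omega, h⟩
    · rintro ⟨i, hi, h⟩
      rcases Nat.lt_succ_iff_lt_or_eq.mp hi with h' | h'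
      · exact Or.inr ⟨i, h', h⟩
      · subst h'; exact Or.inl h.symm

theorem mem_pre_fin (w : Equiv.Perm (Fin 8)) (k x : Fin 8) :
    (x : ℕ) ∈ pre w k ↔ w.symm x < k := by
  rw [mem_pre]
  constructor
  · rintro ⟨i, hi, h⟩
    have hi8 : i < 8 := by omega
    have : w ⟨i, hi8⟩ = x := by
      apply Fin.ext; simpa [wfun, hi8] using h
    rw [← this]; simpa [Fin.lt_def] using hi
  · intro h
    refine ⟨w.symm x, h, ?_⟩
    simp [wfun]

theorem ok_iff (w : Equiv.Perm (Fin 8)) (b : Fin 8) :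
    okB (pre w (w.symm b)) b = true ↔
      ((b : ℕ) % 2 = 1 → ∀ a c : Fin 8, a < b → b < c →
        ¬ (w.symm a < w.symm b ∧ w.symm c < w.symm b)) ∧
      ((b : ℕ) % 2 = 0 → ∀ a c : Fin 8, a < b → b < c →
        ¬ (w.symm b ≤ w.symm a ∧ w.symm b ≤ w.symm c)) := by
  have hb : (b : ℕ) ∉ pre w (w.symm b) := by rw [mem_pre_fin]; exact lt_irrefl _
  have key : ∀ P : ℕ → Bool, (List.range 8).any P = true ↔ ∃ a : Fin 8, P a = true := by
    intro P
    rw [List.any_eq_true]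
    constructor
    · rintro ⟨x, hx, h⟩
      exact ⟨⟨x, List.mem_range.mp hx⟩, h⟩
    · rintro ⟨a, h⟩
      exact ⟨a, List.mem_range.mpr a.2, h⟩
  have hblt : ∀ m n : ℕ, Nat.blt m n = true ↔ m < n := fun m n => by
    simp [Nat.blt]
  unfold okB
  rcases Nat.mod_two_eq_zero_or_one (b : ℕ) with h | h
  · rw [h]
    simp only [Bool.and_eq_true, Bool.not_eq_true', ← Bool.not_eq_true, key, hblt,
      List.elem_eq_mem, decide_eq_true_eq, mem_pre_fin, Fin.val_fin_lt, not_lt]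
    constructor
    · rintro ⟨-, h2⟩
      exact ⟨by omega, fun _ a c hab hbc h3 => h2 ⟨⟨a, hab, h3.1⟩, ⟨c, hbc, h3.2⟩⟩⟩
    · rintro ⟨-, h2⟩
      refine ⟨le_rfl, ?_⟩
      rintro ⟨⟨a, ha, ha'⟩, ⟨c, hc, hc'⟩⟩
      exact h2 trivial a c ha hc ⟨ha', hc'⟩
  · rw [h]
    simp only [Bool.and_eq_true, Bool.not_eq_true', ← Bool.not_eq_true, key, hblt,
      List.elem_eq_mem, decide_eq_true_eq, mem_pre_fin, Fin.val_fin_lt, not_lt]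
    constructor
    · rintro ⟨-, h2⟩
      exact ⟨fun _ a c hab hbc h3 => h2 ⟨⟨a, hab, h3.1⟩, ⟨c, hbc, h3.2⟩⟩, by omega⟩
    · rintro ⟨h2, -⟩
      refine ⟨le_rfl, ?_⟩
      rintro ⟨⟨a, ha, ha'⟩, ⟨c, hc, hc'⟩⟩
      exact h2 trivial a c ha hc ⟨ha', hc'⟩

theorem rank_eq (w : Equiv.Perm (Fin 8)) (a b c : Fin 8) (hab : a < b) (hbc : b < c) :
    tripleRank w a b c b =
      (if w.symm a < w.symm b then 1 else 0) + 1 + (if w.symm c < w.symm b then 1 else 0) := by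
  have h1 : a ≠ b := hab.ne
  have h2 : b ≠ c := hbc.ne
  have h3 : a ≠ c := (hab.trans hbc).ne
  have e1 : w.symm a ≤ w.symm b ↔ w.symm a < w.symm b :=
    ⟨fun h => lt_of_le_of_ne h (fun e => h1 (w.symm.injective e)), le_of_lt⟩
  have e2 : w.symm c ≤ w.symm b ↔ w.symm c < w.symm b :=
    ⟨fun h => lt_of_le_of_ne h (fun e => h2 (w.symm.injective e).symm), le_of_lt⟩
  unfold tripleRank
  rw [Finset.card_filter, Finset.sum_insert (by simp [h1, h3]), Finset.sum_insert (by simp [h2]),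
    Finset.sum_singleton]
  simp only [e1, e2, le_refl, if_true]
  ring

theorem fish_iff (w : Equiv.Perm (Fin 8)) :
    w ∈ Fishburn8 ↔ ∀ b : Fin 8, okB (pre w (w.symm b)) b = true := by
  simp only [ok_iff]
  have e : ∀ b : Fin 8, (Even ((b : ℕ) + 1) ↔ (b : ℕ) % 2 = 1) ∧
      (Odd ((b : ℕ) + 1) ↔ (b : ℕ) % 2 = 0) := by
    intro b; rw [Nat.even_iff, Nat.odd_iff]; omega
  have r3 : ∀ a b c : Fin 8, a < b → b < c → (tripleRank w a b c b ≠ 3 ↔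
      ¬ (w.symm a < w.symm b ∧ w.symm c < w.symm b)) := by
    intro a b c hab hbc
    rw [rank_eq w a b c hab hbc]
    split_ifs <;> simp_all
  have r1 : ∀ a b c : Fin 8, a < b → b < c → (tripleRank w a b c b ≠ 1 ↔
      ¬ (w.symm b ≤ w.symm a ∧ w.symm b ≤ w.symm c)) := by
    intro a b c hab hbc
    rw [rank_eq w a b c hab hbc, ← not_lt, ← not_lt]
    split_ifs <;> simp_all
  constructor
  · intro h b
    exact ⟨fun hb a c hab hbc => (r3 a b c hab hbc).1 ((h a b c hab hbc).1 ((e b).1.2 hb)),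
      fun hb a c hab hbc => (r1 a b c hab hbc).1 ((h a b c hab hbc).2 ((e b).2.2 hb))⟩
  · intro h a b c hab hbc
    exact ⟨fun hb => (r3 a b c hab hbc).2 ((h b).1 ((e b).1.1 hb) a c hab hbc),
      fun hb => (r1 a b c hab hbc).2 ((h b).2 ((e b).2.1 hb) a c hab hbc)⟩

theorem fish_iff' (w : Equiv.Perm (Fin 8)) :
    w ∈ Fishburn8 ↔ ∀ k < 8, okB (pre w k) (wfun w k) = true := by
  rw [fish_iff]
  constructor
  · intro h k hk
    have := h (w ⟨k, hk⟩)
    simpa [wfun, hk] using this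
  · intro h b
    have := h (w.symm b) (w.symm b).2
    simpa [wfun] using this

theorem mem_enum_succ (k b : ℕ) (l : List ℕ) :
    b :: l ∈ enumP (k + 1) ↔ l ∈ enumP k ∧ b < 8 ∧ okB l b = true := by
  rw [enumP, List.mem_flatMap]
  constructor
  · rintro ⟨m, hm, h⟩
    simp only [List.mem_map, List.mem_filter, List.mem_range, List.cons.injEq] at h
    obtain ⟨x, ⟨hx, hx'⟩, rfl, rfl⟩ := h
    exact ⟨hm, hx, hx'⟩
  · rintro ⟨hl, hb, hok⟩
    refine ⟨l, hl, ?_⟩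
    simp only [List.mem_map, List.mem_filter, List.mem_range]
    exact ⟨b, ⟨hb, hok⟩, rfl⟩

theorem wfun_lt (w : Equiv.Perm (Fin 8)) (k : ℕ) : wfun w k < 8 := by
  unfold wfun; split_ifs <;> omega

theorem pre_mem_iff (w : Equiv.Perm (Fin 8)) (k : ℕ) :
    pre w k ∈ enumP k ↔ ∀ j < k, okB (pre w j) (wfun w j) = true := by
  induction k with
  | zero => simp [pre, enumP]
  | succ k ih =>
    rw [pre, mem_enum_succ, ih, Nat.forall_lt_succ_right]
    simp [wfun_lt]

theorem enum_props (k : ℕ) : ∀ l ∈ enumP k, l.length = k ∧ l.Nodup ∧ ∀ x ∈ l, x < 8 := by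
  induction k with
  | zero => simp [enumP]
  | succ k ih =>
    intro l hl
    cases l with
    | nil => simp [enumP] at hl
    | cons b l =>
      rw [mem_enum_succ] at hl
      obtain ⟨h1, h2, h3⟩ := hl
      obtain ⟨i1, i2, i3⟩ := ih l h1
      have hb : b ∉ l := by
        intro hb; simp [okB, hb] at h3
      refine ⟨by simp [i1], List.nodup_cons.2 ⟨hb, i2⟩, ?_⟩
      intro x hx
      rcases List.mem_cons.1 hx with rfl | hx
      · exact h2
      · exact i3 x hx

theorem pre_eq (w : Equiv.Perm (Fin 8)) (k : ℕ) :
    pre w k = ((List.range k).map (wfun w)).reverse := by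
  induction k with
  | zero => simp [pre]
  | succ k ih => rw [pre, ih, List.range_succ]; simp

theorem exists_perm (l : List ℕ) (h1 : l.length = 8) (h2 : l.Nodup) (h3 : ∀ x ∈ l, x < 8) :
    ∃ w, pre w 8 = l := by
  have hlen : l.reverse.length = 8 := by simpa using h1
  have hnd : l.reverse.Nodup := List.nodup_reverse.2 h2
  have hlt : ∀ (i : ℕ) (hi : i < l.reverse.length), l.reverse[i] < 8 := fun i hi =>
    h3 _ (List.mem_reverse.1 (List.getElem_mem hi))
  let g : Fin 8 → Fin 8 := fun i => ⟨l.reverse[(i : ℕ)]'(by omega), hlt _ _⟩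
  have hg : Function.Injective g := by
    intro i j hij
    have := congrArg Fin.val hij
    exact Fin.ext ((hnd.getElem_inj_iff).1 this)
  refine ⟨Equiv.ofBijective g (Finite.injective_iff_bijective.1 hg), ?_⟩
  rw [pre_eq, List.reverse_eq_iff]
  apply List.ext_getElem
  · simp [h1]
  · intro i hi hi'
    have hi8 : i < 8 := by omega
    simp only [List.getElem_map, List.getElem_range, wfun, hi8, dif_pos]
    rfl

theorem pre_inj : Function.Injective (fun w : Equiv.Perm (Fin 8) => pre w 8) := by
  intro v w h
  simp only [pre_eq] at h
  have h' := List.map_inj_left.1 (List.reverse_injective h)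
  ext i
  have := h' i (List.mem_range.2 i.2)
  simpa [wfun] using this

/-- The Fishburn domain on 8 alternatives has exactly 222 elements. -/
theorem stmt5 : Fishburn8.ncard = 222 := by
  rw [← Set.ncard_image_of_injective Fishburn8 pre_inj]
  have : (fun w : Equiv.Perm (Fin 8) => pre w 8) '' Fishburn8 =
      ((enumP 8).toFinset : Set (List ℕ)) := by
    ext l
    simp only [Set.mem_image, List.coe_toFinset, Set.mem_setOf_eq]
    constructor
    · rintro ⟨w, hw, rfl⟩
      exact (pre_mem_iff w 8).2 ((fish_iff' w).1 hw)
    · intro hl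
      obtain ⟨h1, h2, h3⟩ := enum_props 8 l hl
      obtain ⟨w, rfl⟩ := exists_perm l h1 h2 h3
      exact ⟨w, (fish_iff' w).2 ((pre_mem_iff w 8).1 hl), rfl⟩
  rw [this, Set.ncard_coe_finset, List.toFinset_card_of_nodup (enum_nodup 8), enum_length]
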